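/- Let A be a nonzero m×n complex matrix with rank factorization PA = LU as above, and set X = U*(UU*)⁻¹(L*L)⁻¹L*P. Then AXA = A. -/

import Mathlib

open Matrix

theorem Matrix.isUnit_det_of_rank_eq_card {ι K : Type*} [Fintype ι] [DecidableEq ι] [Field K]
    (B : Matrix ι ι K) (hB : B.rank = Fintype.card ι) : IsUnit B.det := by
  rw [← isUnit_iff_isUnit_det, ← mulVec_surjective_iff_isUnit]
  have h : LinearMap.range B.mulVecLin = ⊤ :=
    Submodule.eq_top_of_finrank_eq (by rw [Module.finrank_fintype_fun_eq_card]; exact hB)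
  exact LinearMap.range_eq_top.mp h

theorem AXA_eq_A (m n r : ℕ) (A : Matrix (Fin m) (Fin n) ℂ) (hA : A ≠ 0)
    (σ : Equiv.Perm (Fin m)) (L : Matrix (Fin m) (Fin r) ℂ) (U : Matrix (Fin r) (Fin n) ℂ)
    (hL : L.rank = r) (hU : U.rank = r)
    (hfac : (Equiv.Perm.permMatrix ℂ σ) * A = L * U) :
    A * (Uᴴ * (U * Uᴴ)⁻¹ * (Lᴴ * L)⁻¹ * Lᴴ * (Equiv.Perm.permMatrix ℂ σ)) * A = A := by
  have hLL : IsUnit (Lᴴ * L).det := isUnit_det_of_rank_eq_card _ (by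
    open scoped ComplexOrder in
    rw [rank_conjTranspose_mul_self, hL, Fintype.card_fin])
  have hUU : IsUnit (U * Uᴴ).det := isUnit_det_of_rank_eq_card _ (by
    open scoped ComplexOrder in
    rw [rank_self_mul_conjTranspose, hU, Fintype.card_fin])
  have hP : Equiv.Perm.permMatrix ℂ σ⁻¹ * Equiv.Perm.permMatrix ℂ σ = 1 := by
    rw [← permMatrix_mul, mul_inv_cancel, permMatrix_one]
  have hA' : A = Equiv.Perm.permMatrix ℂ σ⁻¹ * (L * U) := by
    rw [← hfac, ← Matrix.mul_assoc, hP, Matrix.one_mul]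
  calc A * (Uᴴ * (U * Uᴴ)⁻¹ * (Lᴴ * L)⁻¹ * Lᴴ * Equiv.Perm.permMatrix ℂ σ) * A
      = A * (Uᴴ * (U * Uᴴ)⁻¹ * (Lᴴ * L)⁻¹ * Lᴴ * (Equiv.Perm.permMatrix ℂ σ * A)) := by
        simp only [Matrix.mul_assoc]
    _ = Equiv.Perm.permMatrix ℂ σ⁻¹ * (L * U) *
          (Uᴴ * (U * Uᴴ)⁻¹ * (Lᴴ * L)⁻¹ * Lᴴ * (L * U)) := by rw [hfac, ← hA']
    _ = Equiv.Perm.permMatrix ℂ σ⁻¹ *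
          (L * ((U * Uᴴ * (U * Uᴴ)⁻¹) * ((Lᴴ * L)⁻¹ * (Lᴴ * L)) * U)) := by
        simp only [Matrix.mul_assoc]
    _ = A := by
        rw [mul_nonsing_inv _ hUU, nonsing_inv_mul _ hLL, Matrix.one_mul, Matrix.one_mul, ← hA']
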